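/- Let n ≥ 1, p ≥ 1, c > 0. The linear map from 𝕌^p to ℙ^p(ℝⁿ) × ℙ^{p−1}(ℝⁿ) sending a space-time Trefftz polynomial U to the pair (U(·,0), ∂ₜU(·,0)) of its initial value and initial time derivative is a linear isomorphism (it is injective and surjective). -/

import Mathlib

open MvPolynomial

/-- The second-order acoustic wave operator `U ↦ −ΔU + c⁻² ∂ₜₜU` acting on real polynomials
in the `n` space variables (indexed by `Sum.inl`) and the time variable (`Sum.inr ()`). -/
noncomputable def waveOp (n : ℕ) (c : ℝ) :
    MvPolynomial (Fin n ⊕ Unit) ℝ →ₗ[ℝ] MvPolynomial (Fin n ⊕ Unit) ℝ :=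
  (c ^ 2)⁻¹ • ((pderiv (Sum.inr ())).toLinearMap ∘ₗ (pderiv (Sum.inr ())).toLinearMap)
    - ∑ m : Fin n, ((pderiv (Sum.inl m)).toLinearMap ∘ₗ (pderiv (Sum.inl m)).toLinearMap)

/-- The second-order polynomial Trefftz space
`𝕌^p = {U ∈ ℙ^p(ℝ^{n+1}) : −ΔU + c⁻²∂ₜₜU = 0}`. -/
noncomputable def trefftzU (n p : ℕ) (c : ℝ) :
    Submodule ℝ (MvPolynomial (Fin n ⊕ Unit) ℝ) :=
  restrictTotalDegree (Fin n ⊕ Unit) ℝ p ⊓ LinearMap.ker (waveOp n c)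

/-- Evaluation at time `t = 0`: the algebra map sending a space-time polynomial `U` to the
polynomial `U(·, 0)` in the space variables only. -/
noncomputable def evalTimeZero (n : ℕ) :
    MvPolynomial (Fin n ⊕ Unit) ℝ →ₐ[ℝ] MvPolynomial (Fin n) ℝ :=
  aeval (Sum.elim X fun _ => 0)

open Finsupp in
lemma coeff_evalTimeZero {n : ℕ} (W : MvPolynomial (Fin n ⊕ Unit) ℝ) (m : Fin n →₀ ℕ) :
    coeff m (evalTimeZero n W) = coeff (m.mapDomain Sum.inl) W := by
  classical
  induction W using MvPolynomial.induction_on generalizing m with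
  | C a =>
    have h : (0 : Fin n ⊕ Unit →₀ ℕ) = m.mapDomain Sum.inl ↔ 0 = m := by
      rw [← mapDomain_zero (f := (Sum.inl : Fin n → Fin n ⊕ Unit))]
      exact (mapDomain_injective Sum.inl_injective).eq_iff
    simp only [evalTimeZero, aeval_C, algebraMap_eq, coeff_C, h]
  | add p q hp hq => simp [hp, hq]
  | mul_X p i hp =>
    rw [map_mul, coeff_mul_X']
    rcases i with j | u
    · have hX : evalTimeZero n (X (Sum.inl j)) = X j := by simp [evalTimeZero]
      have hs : m.mapDomain Sum.inl - single (Sum.inl j : Fin n ⊕ Unit) 1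
          = (m - single j 1).mapDomain Sum.inl := by
        ext (k | k)
        · simp [mapDomain_apply Sum.inl_injective, single_apply]
        · simp [mapDomain_of_notMem_range]
      rw [hX, coeff_mul_X', hs, hp]
      simp [mapDomain_apply Sum.inl_injective]
    · have hX : evalTimeZero n (X (Sum.inr u)) = 0 := by simp [evalTimeZero]
      simp [hX, mapDomain_of_notMem_range]

lemma totalDegree_evalTimeZero_le {n : ℕ} (W : MvPolynomial (Fin n ⊕ Unit) ℝ) :
    (evalTimeZero n W).totalDegree ≤ W.totalDegree := by
  refine Finset.sup_le fun m hm => ?_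
  rw [mem_support_iff, coeff_evalTimeZero, ← mem_support_iff] at hm
  refine le_trans (le_of_eq ?_) (le_totalDegree hm)
  rw [Finsupp.sum_mapDomain_index] <;> simp

lemma totalDegree_pderiv_le {σ : Type*} (i : σ) (W : MvPolynomial σ ℝ) :
    (pderiv i W).totalDegree ≤ W.totalDegree - 1 := by
  classical
  refine Finset.sup_le fun m hm => ?_
  rw [mem_support_iff, coeff_pderiv] at hm
  have h := le_totalDegree (mem_support_iff.2 (left_ne_zero_of_mul hm))
  rw [Finsupp.sum_add_index' (by simp) (by simp)] at h
  simp only [Finsupp.sum_single_index] at h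
  exact Nat.le_sub_of_add_le h

/-- The Laplacian of a polynomial with respect to the variables in the range of `e`. -/
noncomputable def polyLaplacian {n : ℕ} {σ : Type*} (e : Fin n → σ) :
    MvPolynomial σ ℝ →ₗ[ℝ] MvPolynomial σ ℝ :=
  ∑ m : Fin n, ((pderiv (e m)).toLinearMap ∘ₗ (pderiv (e m)).toLinearMap)

lemma polyLaplacian_apply {n : ℕ} {σ : Type*} (e : Fin n → σ) (f : MvPolynomial σ ℝ) :
    polyLaplacian e f = ∑ m : Fin n, pderiv (e m) (pderiv (e m) f) := by
  simp [polyLaplacian]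

lemma waveOp_apply {n : ℕ} (c : ℝ) (W : MvPolynomial (Fin n ⊕ Unit) ℝ) :
    waveOp n c W = (c ^ 2)⁻¹ • pderiv (Sum.inr ()) (pderiv (Sum.inr ()) W)
      - polyLaplacian Sum.inl W := by
  simp [waveOp, polyLaplacian]

lemma iterate_polyLaplacian_degree {n : ℕ} {f : MvPolynomial (Fin n) ℝ} {q : ℕ}
    (hf : f.totalDegree ≤ q) (k : ℕ) (m : Fin n →₀ ℕ)
    (hm : coeff m ((polyLaplacian id)^[k] f) ≠ 0) : m.degree + 2 * k ≤ q := by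
  induction k generalizing m with
  | zero =>
    exact (le_totalDegree (mem_support_iff.2 hm)).trans hf
  | succ k ih =>
    rw [Function.iterate_succ_apply', polyLaplacian_apply, coeff_sum] at hm
    obtain ⟨i, -, hi⟩ := Finset.exists_ne_zero_of_sum_ne_zero hm
    rw [coeff_pderiv, coeff_pderiv] at hi
    have h := ih _ (left_ne_zero_of_mul (left_ne_zero_of_mul hi))
    simp only [map_add, Finsupp.degree_single] at h
    omega

lemma eq_zero_of_waveOp_eq_zero {n : ℕ} {c : ℝ} (hc : 0 < c)
    {W : MvPolynomial (Fin n ⊕ Unit) ℝ} (hW : waveOp n c W = 0)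
    (h0 : evalTimeZero n W = 0) (h1 : evalTimeZero n (pderiv (Sum.inr ()) W) = 0) : W = 0 := by
  classical
  have key : ∀ (k : ℕ) (m : Fin n →₀ ℕ),
      coeff (m.mapDomain Sum.inl + Finsupp.single (Sum.inr ()) k) W = 0 := by
    intro k
    induction k using Nat.twoStepInduction with
    | zero => intro m; simp [← coeff_evalTimeZero, h0]
    | one =>
      intro m
      have h := coeff_evalTimeZero (pderiv (Sum.inr ()) W) m
      rw [h1, coeff_pderiv, coeff_zero] at h
      exact (mul_eq_zero.1 h.symm).resolve_right (by positivity)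
    | more k ih _ =>
      intro m
      have h := congrArg (coeff (m.mapDomain Sum.inl + Finsupp.single (Sum.inr ()) k)) hW
      rw [waveOp_apply, polyLaplacian_apply, coeff_sub, coeff_smul, coeff_sum, coeff_zero,
        Finset.sum_eq_zero, sub_zero, coeff_pderiv, coeff_pderiv, smul_eq_mul] at h
      · have h' := (mul_eq_zero.1 ((mul_eq_zero.1 h).resolve_left (by positivity)))
        have h'' := (mul_eq_zero.1 (h'.resolve_right (by positivity))).resolve_right (by positivity)
        rwa [add_assoc, add_assoc, ← Finsupp.single_add, ← Finsupp.single_add] at h''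
      · intro i _
        have h' := ih (m + Finsupp.single i 1 + Finsupp.single i 1)
        rw [Finsupp.mapDomain_add, Finsupp.mapDomain_add, Finsupp.mapDomain_single,
          add_right_comm, add_right_comm (Finsupp.mapDomain _ _)] at h'
        rw [coeff_pderiv, coeff_pderiv, h', zero_mul, zero_mul]
  ext s
  rw [coeff_zero, ← key (s (Sum.inr ())) (s.comapDomain Sum.inl Sum.inl_injective.injOn)]
  congr 1
  ext (j | u)
  · simp [Finsupp.mapDomain_apply Sum.inl_injective]
  · simp [Finsupp.mapDomain_of_notMem_range]

/-- The space-time polynomial `a tᵏ h(x)`. -/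
noncomputable def timeMonomial {n : ℕ} (a : ℝ) (k : ℕ) (h : MvPolynomial (Fin n) ℝ) :
    MvPolynomial (Fin n ⊕ Unit) ℝ :=
  a • (X (Sum.inr ()) ^ k * rename Sum.inl h)

lemma pderiv_inr_rename_inl {n : ℕ} (h : MvPolynomial (Fin n) ℝ) :
    pderiv (Sum.inr () : Fin n ⊕ Unit) (rename Sum.inl h) = 0 := by
  induction h using MvPolynomial.induction_on with
  | C a => simp
  | add p q hp hq => simp [hp, hq]
  | mul_X p i hp => simp [hp]

lemma pderiv_timeMonomial {n : ℕ} (a : ℝ) (k : ℕ) (h : MvPolynomial (Fin n) ℝ) :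
    pderiv (Sum.inr ()) (timeMonomial a k h) = timeMonomial (a * k) (k - 1) h := by
  rw [timeMonomial, timeMonomial, Derivation.map_smul, pderiv_mul, pderiv_inr_rename_inl, pderiv_pow,
    pderiv_X_self, mul_smul]
  congr 1
  rw [smul_eq_C_mul, map_natCast]
  ring

lemma polyLaplacian_timeMonomial {n : ℕ} (a : ℝ) (k : ℕ) (h : MvPolynomial (Fin n) ℝ) :
    polyLaplacian Sum.inl (timeMonomial a k h) = timeMonomial a k (polyLaplacian id h) := by
  have hX (i : Fin n) : pderiv (Sum.inl i) (X (Sum.inr ()) ^ k : MvPolynomial (Fin n ⊕ Unit) ℝ)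
      = 0 := by
    rw [pderiv_pow, pderiv_X_of_ne (by simp), mul_zero]
  simp [polyLaplacian_apply, timeMonomial, hX, Finset.smul_sum, Finset.mul_sum,
    pderiv_rename Sum.inl_injective]

lemma evalTimeZero_timeMonomial {n : ℕ} (a : ℝ) (k : ℕ) (h : MvPolynomial (Fin n) ℝ) :
    evalTimeZero n (timeMonomial a k h) = a • ((0 : MvPolynomial (Fin n) ℝ) ^ k * h) := by
  have hr : evalTimeZero n (rename Sum.inl h) = h := by
    rw [evalTimeZero, aeval_rename, Sum.elim_comp_inl, aeval_X_left_apply]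
  rw [timeMonomial, map_smul, map_mul, map_pow, hr]
  simp [evalTimeZero]

lemma totalDegree_timeMonomial_le {n : ℕ} (a : ℝ) (k : ℕ) (h : MvPolynomial (Fin n) ℝ) :
    (timeMonomial a k h).totalDegree ≤ k + h.totalDegree := by
  refine (totalDegree_smul_le _ _).trans ((totalDegree_mul _ _).trans ?_)
  rw [totalDegree_X_pow]
  exact Nat.add_le_add_left (totalDegree_rename_le _ _) _

/-- The term of order `2 k + j` in time of the power series solution of the wave equation. -/
noncomputable def waveTerm {n : ℕ} (c : ℝ) (j : ℕ) (f : MvPolynomial (Fin n) ℝ) (k : ℕ) :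
    MvPolynomial (Fin n ⊕ Unit) ℝ :=
  timeMonomial (c ^ (2 * k) / (2 * k + j).factorial) (2 * k + j) ((polyLaplacian id)^[k] f)

lemma pderiv_pderiv_waveTerm_succ {n : ℕ} {c : ℝ} (hc : 0 < c) (j : ℕ)
    (f : MvPolynomial (Fin n) ℝ) (k : ℕ) :
    (c ^ 2)⁻¹ • pderiv (Sum.inr ()) (pderiv (Sum.inr ()) (waveTerm c j f (k + 1)))
      = polyLaplacian Sum.inl (waveTerm c j f k) := by
  rw [waveTerm, waveTerm, polyLaplacian_timeMonomial, pderiv_timeMonomial, pderiv_timeMonomial,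
    ← Function.iterate_succ_apply' (polyLaplacian id)]
  rw [show 2 * (k + 1) + j = 2 * k + j + 1 + 1 by ring]
  simp only [Nat.add_sub_cancel, Nat.factorial_succ, timeMonomial, smul_smul]
  congr 1
  push_cast
  have : (2 * (k : ℝ) + j + 1) ≠ 0 := by positivity
  have : (2 * (k : ℝ) + j + 1 + 1) ≠ 0 := by positivity
  field_simp
  ring

lemma waveOp_sum_waveTerm {n : ℕ} {c : ℝ} (hc : 0 < c) {j : ℕ} (hj : j ≤ 1)
    (f : MvPolynomial (Fin n) ℝ) (N : ℕ) :
    waveOp n c (∑ k ∈ Finset.range (N + 1), waveTerm c j f k)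
      = -polyLaplacian Sum.inl (waveTerm c j f N) := by
  induction N with
  | zero =>
    rw [Finset.sum_range_one, waveOp_apply, waveTerm, pderiv_timeMonomial, pderiv_timeMonomial]
    interval_cases j <;> simp [timeMonomial]
  | succ N ih =>
    rw [Finset.sum_range_succ, map_add, ih, waveOp_apply, pderiv_pderiv_waveTerm_succ hc]
    abel

lemma exists_mem_trefftzU {n p : ℕ} {c : ℝ} (hc : 0 < c) {j : ℕ} (hj : j ≤ 1) (hp : j ≤ p)
    {f : MvPolynomial (Fin n) ℝ} (hf : f.totalDegree ≤ p - j) :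
    ∃ U ∈ trefftzU n p c,
      evalTimeZero n U = (if j = 0 then f else 0) ∧
      evalTimeZero n (pderiv (Sum.inr ()) U) = (if j = 0 then 0 else f) := by
  refine ⟨∑ k ∈ Finset.range (p + 1), waveTerm c j f k, Submodule.mem_inf.2 ⟨?_, ?_⟩, ?_, ?_⟩
  · refine Submodule.sum_mem _ fun k _ => ?_
    rw [mem_restrictTotalDegree]
    by_cases h0 : (polyLaplacian id)^[k] f = 0
    · simp [waveTerm, timeMonomial, h0]
    refine (totalDegree_timeMonomial_le _ _ _).trans ?_
    obtain ⟨m, hm, hdeg⟩ := Finset.exists_mem_eq_sup _ (support_nonempty.2 h0)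
      (fun s : Fin n →₀ ℕ => s.sum fun _ e => e)
    have h := iterate_polyLaplacian_degree hf k m (mem_support_iff.1 hm)
    have hd : ((polyLaplacian id)^[k] f).totalDegree = m.degree := hdeg
    omega
  · have hz : (polyLaplacian id)^[p + 1] f = 0 := by
      ext m
      by_contra hm
      have := iterate_polyLaplacian_degree hf (p + 1) m hm
      omega
    rw [LinearMap.mem_ker, waveOp_sum_waveTerm hc hj, waveTerm, polyLaplacian_timeMonomial,
      ← Function.iterate_succ_apply' (polyLaplacian id), hz]
    simp [timeMonomial]
  · rw [map_sum, Finset.sum_eq_single_of_mem 0 (by simp)]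
    · rw [waveTerm, evalTimeZero_timeMonomial]
      interval_cases j <;> simp
    · intro k _ hk
      rw [waveTerm, evalTimeZero_timeMonomial, zero_pow (by omega)]
      simp
  · rw [map_sum, map_sum, Finset.sum_eq_single_of_mem 0 (by simp)]
    · rw [waveTerm, pderiv_timeMonomial, evalTimeZero_timeMonomial]
      interval_cases j <;> simp
    · intro k _ hk
      rw [waveTerm, pderiv_timeMonomial, evalTimeZero_timeMonomial, zero_pow (by omega)]
      simp

/-- The linear map `𝕌^p → ℙ^p(ℝⁿ) × ℙ^{p−1}(ℝⁿ)`,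
`U ↦ (U(·,0), ∂ₜU(·,0))`, is a linear isomorphism: it maps `𝕌^p` into
`ℙ^p(ℝⁿ) × ℙ^{p−1}(ℝⁿ)`, is injective, and is surjective onto `ℙ^p(ℝⁿ) × ℙ^{p−1}(ℝⁿ)`. -/
theorem trefftz_cauchyData_linearIso (n p : ℕ) (hn : 1 ≤ n) (hp : 1 ≤ p) (c : ℝ)
    (hc : 0 < c) :
    -- the map sends `𝕌^p` into `ℙ^p(ℝⁿ) × ℙ^{p−1}(ℝⁿ)`
    (∀ U ∈ trefftzU n p c,
      (evalTimeZero n U).totalDegree ≤ p ∧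
      (evalTimeZero n (pderiv (Sum.inr ()) U)).totalDegree ≤ p - 1) ∧
    -- injectivity
    (∀ U ∈ trefftzU n p c, ∀ V ∈ trefftzU n p c,
      evalTimeZero n U = evalTimeZero n V →
      evalTimeZero n (pderiv (Sum.inr ()) U) = evalTimeZero n (pderiv (Sum.inr ()) V) →
      U = V) ∧
    -- surjectivity
    (∀ f g : MvPolynomial (Fin n) ℝ, f.totalDegree ≤ p → g.totalDegree ≤ p - 1 →
      ∃ U ∈ trefftzU n p c,
        evalTimeZero n U = f ∧ evalTimeZero n (pderiv (Sum.inr ()) U) = g) := by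
  refine ⟨fun U hU => ?_, fun U hU V hV h0 h1 => ?_, fun f g hf hg => ?_⟩
  · have hd := (mem_restrictTotalDegree _ _ _).1 (Submodule.mem_inf.1 hU).1
    exact ⟨(totalDegree_evalTimeZero_le U).trans hd, (totalDegree_evalTimeZero_le _).trans
      ((totalDegree_pderiv_le _ U).trans (Nat.sub_le_sub_right hd 1))⟩
  · refine sub_eq_zero.1 (eq_zero_of_waveOp_eq_zero hc ?_ ?_ ?_)
    · exact LinearMap.mem_ker.1 (Submodule.mem_inf.1 (Submodule.sub_mem _ hU hV)).2
    · rw [map_sub, h0, sub_self]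
    · rw [map_sub, map_sub, h1, sub_self]
  · obtain ⟨U, hU, hU0, hU1⟩ := exists_mem_trefftzU hc (j := 0) zero_le_one p.zero_le hf
    obtain ⟨V, hV, hV0, hV1⟩ := exists_mem_trefftzU hc (j := 1) le_rfl hp hg
    refine ⟨U + V, Submodule.add_mem _ hU hV, ?_, ?_⟩
    · simp [hU0, hV0]
    · simp [hU1, hV1]
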